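/- arXiv:1911.09761 — 3 statements merged into one kernel-verified Lean document; each statement's English description precedes it below -/
import Mathlib

section
/- Let n, m be positive integers, let W be a real n × m matrix with WᵀW invertible, let x, z ∈ ℝⁿ, and let P = Iₙ − W(WᵀW)⁻¹Wᵀ. Assume zᵀPz > 0 and set c = sqrt((xᵀPx)/(zᵀPz)). Let M be the real n × (m+2) matrix whose first column is x + c z, whose second column is x − c z, and whose remaining m columns are the columns of W. Then (x + c z)ᵀ P (x − c z) = 0, and, if MᵀM is invertible, the (1,2) entry of (MᵀM)⁻¹ equals 0. -/
open Matrix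

/-- For an `n × m` matrix `W` with `WᵀW` invertible, vectors `x, z ∈ ℝⁿ`,
the projection `P = Iₙ − W(WᵀW)⁻¹Wᵀ`, and (assuming `zᵀPz > 0`) the mirror scale
`c = sqrt((xᵀPx)/(zᵀPz))`, the mirror design `M = (x + cz, x − cz, W)` satisfies
`(x + cz)ᵀ P (x − cz) = 0`, and if `MᵀM` is invertible then the `(1,2)` entry of
`(MᵀM)⁻¹` vanishes. -/
theorem gaussian_mirror_scale_orthogonality
    (n m : ℕ) (hn : 0 < n) (hm : 0 < m)
    (W : Matrix (Fin n) (Fin m) ℝ) (hW : IsUnit (Wᵀ * W).det)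
    (x z : Fin n → ℝ)
    (P : Matrix (Fin n) (Fin n) ℝ) (hP : P = 1 - W * (Wᵀ * W)⁻¹ * Wᵀ)
    (hz : 0 < z ⬝ᵥ P *ᵥ z)
    (c : ℝ) (hc : c = Real.sqrt ((x ⬝ᵥ P *ᵥ x) / (z ⬝ᵥ P *ᵥ z)))
    (M : Matrix (Fin n) (Fin 2 ⊕ Fin m) ℝ)
    (hM : M = Matrix.of fun i j =>
      Sum.elim (fun k : Fin 2 => if k = 0 then x i + c * z i else x i - c * z i)
        (fun k : Fin m => W i k) j) :
    ((fun i => x i + c * z i) ⬝ᵥ P *ᵥ (fun i => x i - c * z i)) = 0 ∧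
      (IsUnit (Mᵀ * M).det → (Mᵀ * M)⁻¹ (Sum.inl 0) (Sum.inl 1) = 0) := by
  have hPt : Pᵀ = P := by
    subst hP
    simp [Matrix.transpose_sub, Matrix.transpose_mul, Matrix.transpose_nonsing_inv, Matrix.mul_assoc]
  have hPW : P * W = 0 := by
    subst hP
    rw [Matrix.sub_mul, Matrix.one_mul, Matrix.mul_assoc, Matrix.mul_assoc,
      Matrix.nonsing_inv_mul _ hW, Matrix.mul_one, sub_self]
  have hPP : P * P = P := by
    conv_lhs => rw [hP, Matrix.mul_sub, ← hP]
    rw [← Matrix.mul_assoc, ← Matrix.mul_assoc, hPW]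
    simp
  have hsym : ∀ u v : Fin n → ℝ, u ⬝ᵥ P *ᵥ v = (P *ᵥ u) ⬝ᵥ v := by
    intro u v
    rw [Matrix.dotProduct_mulVec, ← Matrix.mulVec_transpose, hPt]
  have hquad : ∀ u : Fin n → ℝ, u ⬝ᵥ P *ᵥ u = (P *ᵥ u) ⬝ᵥ (P *ᵥ u) := by
    intro u
    rw [← hsym, Matrix.mulVec_mulVec, hPP]
  have hfix : ∀ y : Fin n → ℝ, Wᵀ *ᵥ y = 0 → P *ᵥ y = y := by
    intro y hy
    rw [hP, Matrix.sub_mulVec, Matrix.one_mulVec, ← Matrix.mulVec_mulVec, hy]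
    simp
  have hx : 0 ≤ x ⬝ᵥ P *ᵥ x := by
    rw [hquad]
    exact Finset.sum_nonneg fun i _ => mul_self_nonneg _
  have hc2 : c * c * (z ⬝ᵥ P *ᵥ z) = x ⬝ᵥ P *ᵥ x := by
    rw [hc, Real.mul_self_sqrt (div_nonneg hx hz.le), div_mul_cancel₀ _ hz.ne']
  obtain ⟨a, ha⟩ : ∃ a : Fin n → ℝ, a = fun i => x i + c * z i := ⟨_, rfl⟩
  obtain ⟨b, hb⟩ : ∃ b : Fin n → ℝ, b = fun i => x i - c * z i := ⟨_, rfl⟩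
  have hab : a ⬝ᵥ P *ᵥ b = 0 := by
    have ha' : a = x + c • z := by rw [ha]; rfl
    have hb' : b = x - c • z := by rw [hb]; rfl
    have hxz : z ⬝ᵥ P *ᵥ x = x ⬝ᵥ P *ᵥ z := by rw [hsym, dotProduct_comm]
    rw [ha', hb', Matrix.mulVec_sub, Matrix.mulVec_smul]
    simp only [add_dotProduct, dotProduct_sub, smul_dotProduct, dotProduct_smul, smul_eq_mul, hxz]
    linarith
  rw [← ha, ← hb]
  refine ⟨hab, fun hdet => ?_⟩
  have hMa : ∀ y : Fin n → ℝ, (Mᵀ *ᵥ y) (Sum.inl 0) = a ⬝ᵥ y := by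
    intro y
    simp [hM, ha, Matrix.mulVec, dotProduct]
  have hMW : ∀ (y : Fin n → ℝ) (k : Fin m), (Mᵀ *ᵥ y) (Sum.inr k) = (Wᵀ *ᵥ y) k := by
    intro y k
    simp [hM, Matrix.mulVec, dotProduct]
  have hMv : ∀ v : Fin 2 ⊕ Fin m → ℝ,
      M *ᵥ v = v (Sum.inl 0) • a + v (Sum.inl 1) • b + W *ᵥ (fun k => v (Sum.inr k)) := by
    intro v
    ext i
    simp [hM, ha, hb, Matrix.mulVec, dotProduct, Fintype.sum_sum_type, Fin.sum_univ_two]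
    ring
  have key : ∀ s : Fin 2, ∃ y : Fin n → ℝ,
      y = M *ᵥ (fun j => (Mᵀ * M)⁻¹ j (Sum.inl s)) ∧ P *ᵥ y = y ∧
        a ⬝ᵥ y = (1 : Matrix (Fin 2 ⊕ Fin m) (Fin 2 ⊕ Fin m) ℝ) (Sum.inl 0) (Sum.inl s) := by
    intro s
    have h1 : ∀ j, (Mᵀ *ᵥ (M *ᵥ (fun j => (Mᵀ * M)⁻¹ j (Sum.inl s)))) j
        = (1 : Matrix (Fin 2 ⊕ Fin m) (Fin 2 ⊕ Fin m) ℝ) j (Sum.inl s) := by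
      intro j
      rw [Matrix.mulVec_mulVec, ← Matrix.mul_nonsing_inv _ hdet]
      rfl
    refine ⟨_, rfl, hfix _ ?_, ?_⟩
    · ext k
      rw [← hMW, h1]
      simp
    · rw [← hMa, h1]
  obtain ⟨y, hy, hPy, hay⟩ := key 1
  obtain ⟨y', -, hPy', hay'⟩ := key 0
  have h0 : (Mᵀ * M)⁻¹ (Sum.inl 0) (Sum.inl 1) * (a ⬝ᵥ P *ᵥ a) = 0 := by
    rw [← hPy, hy, hMv, Matrix.mulVec_add, Matrix.mulVec_add, Matrix.mulVec_smul,
      Matrix.mulVec_smul, Matrix.mulVec_mulVec, hPW] at hay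
    simpa [dotProduct_add, dotProduct_smul, hab] using hay
  rcases mul_eq_zero.mp h0 with h | h
  · exact h
  · exfalso
    rw [hquad] at h
    have hPa : P *ᵥ a = 0 := dotProduct_self_eq_zero.mp h
    rw [← hPy', hsym, hPa] at hay'
    simp at hay'
end

section
/- Let X_S be a real n × s matrix with linearly independent columns (s ≤ n), let P_S = X_S(X_SᵀX_S)⁻¹X_Sᵀ be the orthogonal projection onto its column space, and let X_{-S} be a real n × (p − s) matrix. Fix a column x of X_S, let W be the n × (s−1) matrix of the remaining columns of X_S (with WᵀW invertible), let z ∈ ℝⁿ, set z̃ = (Iₙ − P_S)z, let P = Iₙ − W(WᵀW)⁻¹Wᵀ, assume z̃ᵀPz̃ > 0, set c = sqrt((xᵀPx)/(z̃ᵀPz̃)), and let M = (x + c z̃, x − c z̃, W), assumed to have MᵀM invertible. Define ψ₁ = M(MᵀM)⁻¹e₁ and ψ₂ = M(MᵀM)⁻¹e₂ in ℝⁿ, where e₁, e₂ are the first two standard basis vectors of ℝ^{s+1}. Then X_{-S}ᵀ(Iₙ − P_S)(ψ₁ + ψ₂) = 0 and X_Sᵀ(ψ₁ − ψ₂) = 0.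 Consequently, for A₀ = (1/λ)·[X_{-S}ᵀ(Iₙ − P_S); −X_{-S}ᵀ(Iₙ − P_S)] (any λ ≠ 0) and any matrix A₁ of the form A₁ = D (X_SᵀX_S)⁻¹X_Sᵀ with D an s × s matrix, there exist vectors a₀ and a₁ such that A₀(ψ₁, ψ₂) = a₀·(1, −1) and A₁(ψ₁, ψ₂) = a₁·(1, 1). -/
open Matrix

/-- **Lemma 3 of the paper.** For the post-selection mirror design
`M = (x + c z̃, x − c z̃, W)` built from a selected design `X_S` (a distinguished column
`x` together with the remaining columns `W`), `z̃ = (Iₙ − P_S)z`,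
`P = Iₙ − W(WᵀW)⁻¹Wᵀ` and `c = sqrt((xᵀPx)/(z̃ᵀPz̃))`, and `ψ_ℓ = M(MᵀM)⁻¹e_ℓ`, one has
`X_{-S}ᵀ(Iₙ − P_S)(ψ₁ + ψ₂) = 0` and `X_Sᵀ(ψ₁ − ψ₂) = 0`; consequently the inactive
constraint matrix `A₀ = λ⁻¹[X_{-S}ᵀ(Iₙ − P_S); −X_{-S}ᵀ(Iₙ − P_S)]` satisfies
`A₀(ψ₁, ψ₂) = a₀(1, −1)` and any active constraint matrix `A₁ = D(X_SᵀX_S)⁻¹X_Sᵀ`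
satisfies `A₁(ψ₁, ψ₂) = a₁(1, 1)`. -/
theorem post_selection_mirror_constraints
    (n m r : ℕ)
    (x : Fin n → ℝ) (W : Matrix (Fin n) (Fin m) ℝ)
    (XS : Matrix (Fin n) (Unit ⊕ Fin m) ℝ)
    (hXS : XS = Matrix.of fun i l => Sum.elim (fun _ : Unit => x i) (fun k : Fin m => W i k) l)
    (hli : LinearIndependent ℝ fun l : Unit ⊕ Fin m => (fun i => XS i l))
    (hWInv : IsUnit (Wᵀ * W).det)
    (XmS : Matrix (Fin n) (Fin r) ℝ)
    (PS : Matrix (Fin n) (Fin n) ℝ) (hPS : PS = XS * (XSᵀ * XS)⁻¹ * XSᵀ)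
    (z zt : Fin n → ℝ) (hzt : zt = (1 - PS) *ᵥ z)
    (Pm : Matrix (Fin n) (Fin n) ℝ) (hPm : Pm = 1 - W * (Wᵀ * W)⁻¹ * Wᵀ)
    (hztP : 0 < zt ⬝ᵥ Pm *ᵥ zt)
    (c : ℝ) (hc : c = Real.sqrt ((x ⬝ᵥ Pm *ᵥ x) / (zt ⬝ᵥ Pm *ᵥ zt)))
    (M : Matrix (Fin n) (Fin 2 ⊕ Fin m) ℝ)
    (hM : M = Matrix.of fun i l =>
      Sum.elim (fun t : Fin 2 => if t = 0 then x i + c * zt i else x i - c * zt i)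
        (fun k : Fin m => W i k) l)
    (hMInv : IsUnit (Mᵀ * M).det)
    (ψ₁ ψ₂ : Fin n → ℝ)
    (hψ₁ : ψ₁ = M *ᵥ ((Mᵀ * M)⁻¹ *ᵥ Pi.single (Sum.inl 0) 1))
    (hψ₂ : ψ₂ = M *ᵥ ((Mᵀ * M)⁻¹ *ᵥ Pi.single (Sum.inl 1) 1)) :
    (XmSᵀ * (1 - PS)) *ᵥ (ψ₁ + ψ₂) = 0 ∧
    XSᵀ *ᵥ (ψ₁ - ψ₂) = 0 ∧
    (∀ lam : ℝ, lam ≠ 0 →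
      ∀ A₀ : Matrix (Fin r ⊕ Fin r) (Fin n) ℝ,
        A₀ = lam⁻¹ • Matrix.fromRows (XmSᵀ * (1 - PS)) (-(XmSᵀ * (1 - PS))) →
        ∃ a₀ : Fin r ⊕ Fin r → ℝ, A₀ *ᵥ ψ₁ = a₀ ∧ A₀ *ᵥ ψ₂ = -a₀) ∧
    (∀ D : Matrix (Unit ⊕ Fin m) (Unit ⊕ Fin m) ℝ,
      ∀ A₁ : Matrix (Unit ⊕ Fin m) (Fin n) ℝ,
        A₁ = D * (XSᵀ * XS)⁻¹ * XSᵀ →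
        ∃ a₁ : Unit ⊕ Fin m → ℝ, A₁ *ᵥ ψ₁ = a₁ ∧ A₁ *ᵥ ψ₂ = a₁) := by
  have hinj : Function.Injective XS.mulVec := Matrix.mulVec_injective_iff.mpr hli
  have hU : IsUnit (XSᵀ * XS).det := by
    have h := Matrix.PosDef.conjTranspose_mul_self XS hinj
    rw [Matrix.conjTranspose_eq_transpose_of_trivial] at h
    exact (Matrix.isUnit_iff_isUnit_det _).mp h.isUnit
  have hPX : (1 - PS) * XS = 0 := by
    rw [Matrix.sub_mul, Matrix.one_mul, hPS, Matrix.mul_assoc, Matrix.mul_assoc,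
      Matrix.nonsing_inv_mul _ hU, Matrix.mul_one, sub_self]
  have hXP : XSᵀ * (1 - PS) = 0 := by
    rw [Matrix.mul_sub, Matrix.mul_one, hPS, ← Matrix.mul_assoc, ← Matrix.mul_assoc,
      Matrix.mul_nonsing_inv _ hU, Matrix.one_mul, sub_self]
  have hXz : XSᵀ *ᵥ zt = 0 := by
    rw [hzt, Matrix.mulVec_mulVec, hXP, Matrix.zero_mulVec]
  have hM1 : Mᵀ *ᵥ ψ₁ = Pi.single (Sum.inl 0) 1 := by
    rw [hψ₁, Matrix.mulVec_mulVec, Matrix.mulVec_mulVec, Matrix.mul_nonsing_inv _ hMInv,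
      Matrix.one_mulVec]
  have hM2 : Mᵀ *ᵥ ψ₂ = Pi.single (Sum.inl 1) 1 := by
    rw [hψ₂, Matrix.mulVec_mulVec, Matrix.mulVec_mulVec, Matrix.mul_nonsing_inv _ hMInv,
      Matrix.one_mulVec]
  -- coordinates of the transpose of M applied to a vector
  have hMa : ∀ v : Fin n → ℝ, (Mᵀ *ᵥ v) (Sum.inl 0) = x ⬝ᵥ v + c * (zt ⬝ᵥ v) := by
    intro v
    simp [hM, Matrix.mulVec, dotProduct, add_mul, Finset.sum_add_distrib, Finset.mul_sum,
      mul_assoc]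
  have hMb : ∀ v : Fin n → ℝ, (Mᵀ *ᵥ v) (Sum.inl 1) = x ⬝ᵥ v - c * (zt ⬝ᵥ v) := by
    intro v
    simp [hM, Matrix.mulVec, dotProduct, sub_mul, Finset.sum_sub_distrib, Finset.mul_sum,
      mul_assoc]
  have hMw : ∀ (v : Fin n → ℝ) (k : Fin m), (Mᵀ *ᵥ v) (Sum.inr k) = (XSᵀ *ᵥ v) (Sum.inr k) := by
    intro v k
    simp [hM, hXS, Matrix.mulVec, dotProduct]
  have hXx : ∀ v : Fin n → ℝ, (XSᵀ *ᵥ v) (Sum.inl ()) = x ⬝ᵥ v := by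
    intro v
    simp [hXS, Matrix.mulVec, dotProduct]
  have a1 := hMa ψ₁
  have a2 := hMa ψ₂
  have b1 := hMb ψ₁
  have b2 := hMb ψ₂
  rw [hM1] at a1 b1
  rw [hM2] at a2 b2
  simp at a1 a2 b1 b2
  have hact : XSᵀ *ᵥ (ψ₁ - ψ₂) = 0 := by
    ext l
    rcases l with ⟨⟩ | k
    · rw [hXx, dotProduct_sub, Pi.zero_apply]
      linarith
    · rw [← hMw, Matrix.mulVec_sub, hM1, hM2]
      simp
  have hzz : zt ⬝ᵥ zt ≠ 0 := by
    intro h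
    rw [dotProduct_self_eq_zero] at h
    rw [h] at hztP
    simp at hztP
  have hMv : ∀ v : Fin 2 ⊕ Fin m → ℝ, M *ᵥ v =
      XS *ᵥ (Sum.elim (fun _ => v (Sum.inl 0) + v (Sum.inl 1)) (fun k => v (Sum.inr k)))
        + (c * (v (Sum.inl 0) - v (Sum.inl 1))) • zt := by
    intro v
    ext i
    simp [hM, hXS, Matrix.mulVec, dotProduct, Fintype.sum_sum_type, Fin.sum_univ_two]
    ring
  have hsum : (1 - PS) *ᵥ (ψ₁ + ψ₂) = 0 := by
    obtain ⟨v, hv⟩ : ∃ v, ψ₁ + ψ₂ = M *ᵥ v := by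
      rw [hψ₁, hψ₂, ← Matrix.mulVec_add]
      exact ⟨_, rfl⟩
    have hd : c * (zt ⬝ᵥ (ψ₁ + ψ₂)) = 0 := by
      rw [dotProduct_add]
      linarith
    have hzX : ∀ u, zt ⬝ᵥ XS *ᵥ u = 0 := by
      intro u
      rw [Matrix.dotProduct_mulVec, ← Matrix.mulVec_transpose, hXz, zero_dotProduct]
    rw [hv, hMv, dotProduct_add, hzX, dotProduct_smul, zero_add, smul_eq_mul] at hd
    have h0 : c * (v (Sum.inl 0) - v (Sum.inl 1)) = 0 := by
      rcases mul_eq_zero.mp hd with h | h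
      · rw [h, zero_mul]
      · exact (mul_eq_zero.mp h).resolve_right hzz
    rw [hv, hMv, h0, zero_smul, add_zero, Matrix.mulVec_mulVec, hPX, Matrix.zero_mulVec]
  have hin : (XmSᵀ * (1 - PS)) *ᵥ (ψ₁ + ψ₂) = 0 := by
    rw [← Matrix.mulVec_mulVec, hsum, Matrix.mulVec_zero]
  refine ⟨hin, hact, ?_, ?_⟩
  · intro lam _ A₀ hA
    refine ⟨_, rfl, ?_⟩
    have : A₀ *ᵥ (ψ₁ + ψ₂) = 0 := by
      rw [hA, Matrix.smul_mulVec, Matrix.fromRows_mulVec, Matrix.neg_mulVec, hin]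
      ext l
      rcases l with l | l <;> simp
    rw [Matrix.mulVec_add] at this
    exact eq_neg_of_add_eq_zero_right this
  · intro D A₁ hA
    refine ⟨_, rfl, ?_⟩
    have : A₁ *ᵥ (ψ₁ - ψ₂) = 0 := by
      rw [hA, ← Matrix.mulVec_mulVec, hact, Matrix.mulVec_zero]
    rw [Matrix.mulVec_sub] at this
    exact (sub_eq_zero.mp this).symm
end

section
/- Let X_S be a real n × s matrix with linearly independent columns, let P_S = X_S(X_SᵀX_S)⁻¹X_Sᵀ, fix a column x of X_S and let W be the n × (s−1) matrix of the remaining columns of X_S (with WᵀW invertible). Let z ∈ ℝⁿ, set z̃ = (Iₙ − P_S)z, let P = Iₙ − W(WᵀW)⁻¹Wᵀ, assume z̃ᵀPz̃ > 0, set c = sqrt((xᵀPx)/(z̃ᵀPz̃)), and let M = (x + c z̃, x − c z̃, W), assumed to have MᵀM invertible. Then the top-left 2 × 2 block of (MᵀM)⁻¹ satisfies: ((MᵀM)⁻¹)₁₁ = ((MᵀM)⁻¹)₂₂ and ((MᵀM)⁻¹)₁₂ = 0. Equivalently, writing ψ_ℓ = M(MᵀM)⁻¹e_ℓ, one has ψ₁ᵀψ₁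 = ψ₂ᵀψ₂ and (ψ₁ + ψ₂)ᵀ(ψ₁ − ψ₂) = 0. -/
open Matrix

/-- **Section 3 of the paper.** For the post-selection mirror design
`M = (x + c z̃, x − c z̃, W)` with `z̃ = (Iₙ − P_S)z`, `P = Iₙ − W(WᵀW)⁻¹Wᵀ` and
`c = sqrt((xᵀPx)/(z̃ᵀPz̃))`, the top-left `2 × 2` block of `(MᵀM)⁻¹` satisfies
`((MᵀM)⁻¹)₁₁ = ((MᵀM)⁻¹)₂₂` and `((MᵀM)⁻¹)₁₂ = 0`; equivalently, with
`ψ_ℓ = M(MᵀM)⁻¹e_ℓ`, one has `ψ₁ᵀψ₁ = ψ₂ᵀψ₂` and `(ψ₁ + ψ₂)ᵀ(ψ₁ − ψ₂) = 0`. -/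
theorem post_selection_mirror_gram_inverse_block
    (n m : ℕ)
    (x : Fin n → ℝ) (W : Matrix (Fin n) (Fin m) ℝ)
    (XS : Matrix (Fin n) (Unit ⊕ Fin m) ℝ)
    (hXS : XS = Matrix.of fun i l => Sum.elim (fun _ : Unit => x i) (fun k : Fin m => W i k) l)
    (hli : LinearIndependent ℝ fun l : Unit ⊕ Fin m => (fun i => XS i l))
    (hWInv : IsUnit (Wᵀ * W).det)
    (PS : Matrix (Fin n) (Fin n) ℝ) (hPS : PS = XS * (XSᵀ * XS)⁻¹ * XSᵀ)
    (z zt : Fin n → ℝ) (hzt : zt = (1 - PS) *ᵥ z)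
    (Pm : Matrix (Fin n) (Fin n) ℝ) (hPm : Pm = 1 - W * (Wᵀ * W)⁻¹ * Wᵀ)
    (hztP : 0 < zt ⬝ᵥ Pm *ᵥ zt)
    (c : ℝ) (hc : c = Real.sqrt ((x ⬝ᵥ Pm *ᵥ x) / (zt ⬝ᵥ Pm *ᵥ zt)))
    (M : Matrix (Fin n) (Fin 2 ⊕ Fin m) ℝ)
    (hM : M = Matrix.of fun i l =>
      Sum.elim (fun t : Fin 2 => if t = 0 then x i + c * zt i else x i - c * zt i)
        (fun k : Fin m => W i k) l)
    (hMInv : IsUnit (Mᵀ * M).det)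
    (ψ₁ ψ₂ : Fin n → ℝ)
    (hψ₁ : ψ₁ = M *ᵥ ((Mᵀ * M)⁻¹ *ᵥ Pi.single (Sum.inl 0) 1))
    (hψ₂ : ψ₂ = M *ᵥ ((Mᵀ * M)⁻¹ *ᵥ Pi.single (Sum.inl 1) 1)) :
    (Mᵀ * M)⁻¹ (Sum.inl 0) (Sum.inl 0) = (Mᵀ * M)⁻¹ (Sum.inl 1) (Sum.inl 1) ∧
    (Mᵀ * M)⁻¹ (Sum.inl 0) (Sum.inl 1) = 0 ∧
    ψ₁ ⬝ᵥ ψ₁ = ψ₂ ⬝ᵥ ψ₂ ∧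
    (ψ₁ + ψ₂) ⬝ᵥ (ψ₁ - ψ₂) = 0 := by
  -- the Gram matrix of `XS` is invertible
  have hXdet : IsUnit (XSᵀ * XS).det := by
    have hinj : Function.Injective XS.mulVec := by
      rw [Matrix.mulVec_injective_iff]
      exact hli
    have hpd : (XSᴴ * XS).PosDef := Matrix.PosDef.conjTranspose_mul_self XS hinj
    rw [Matrix.conjTranspose_eq_transpose_of_trivial] at hpd
    exact (Matrix.isUnit_iff_isUnit_det _).1 hpd.isUnit
  have hXz : XSᵀ *ᵥ zt = 0 := by
    have h0 : XSᵀ * (1 - PS) = 0 := by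
      rw [hPS, Matrix.mul_sub, Matrix.mul_one, ← Matrix.mul_assoc, ← Matrix.mul_assoc,
        Matrix.mul_nonsing_inv _ hXdet, Matrix.one_mul, sub_self]
    rw [hzt, Matrix.mulVec_mulVec, h0, Matrix.zero_mulVec]
  have hxz : x ⬝ᵥ zt = 0 := by
    have h := congrFun hXz (Sum.inl ())
    simpa [hXS, Matrix.mulVec, dotProduct] using h
  have hWz : Wᵀ *ᵥ zt = 0 := by
    ext k
    have h := congrFun hXz (Sum.inr k)
    simpa [hXS, Matrix.mulVec, dotProduct] using h
  have hPz : Pm *ᵥ zt = zt := by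
    rw [hPm, Matrix.sub_mulVec, Matrix.one_mulVec, ← Matrix.mulVec_mulVec, hWz,
      Matrix.mulVec_zero, sub_zero]
  obtain ⟨b, hb⟩ : ∃ b, b = (Wᵀ * W)⁻¹ *ᵥ (Wᵀ *ᵥ x) := ⟨_, rfl⟩
  obtain ⟨p, hp⟩ : ∃ p, p = x - W *ᵥ b := ⟨_, rfl⟩
  have hPx : Pm *ᵥ x = p := by
    rw [hp, hb, hPm, Matrix.sub_mulVec, Matrix.one_mulVec, ← Matrix.mulVec_mulVec,
      ← Matrix.mulVec_mulVec]
  have hWp : Wᵀ *ᵥ p = 0 := by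
    rw [hp, hb, Matrix.mulVec_sub, Matrix.mulVec_mulVec, Matrix.mulVec_mulVec,
      Matrix.mul_nonsing_inv _ hWInv, Matrix.one_mulVec, sub_self]
  have hWd : ∀ v : Fin n → ℝ, Wᵀ *ᵥ v = 0 → (W *ᵥ b) ⬝ᵥ v = 0 := by
    intro v hv
    rw [← Matrix.vecMul_transpose, ← Matrix.dotProduct_mulVec, hv, dotProduct_zero]
  have hpp : x ⬝ᵥ p = p ⬝ᵥ p := by
    have h := hWd p hWp
    conv_rhs => rw [hp, sub_dotProduct, ← hp, h, sub_zero]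
  have hpz : zt ⬝ᵥ p = 0 := by
    rw [dotProduct_comm, hp, sub_dotProduct, hxz, hWd zt hWz, sub_zero]
  rw [hPz] at hztP
  have hcc : c * c * (zt ⬝ᵥ zt) = x ⬝ᵥ p := by
    rw [hc, hPx, hPz, Real.mul_self_sqrt, div_mul_cancel₀ _ hztP.ne']
    rw [hpp]
    have : 0 ≤ p ⬝ᵥ p := Finset.sum_nonneg fun i _ => mul_self_nonneg (p i)
    positivity
  obtain ⟨a, ha⟩ : ∃ a, a = x ⬝ᵥ p := ⟨_, rfl⟩
  have key : ∀ t : Fin 2, ∃ k : Fin 2 ⊕ Fin m → ℝ,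
      (∀ s, k (Sum.inl s) = if s = t then 1 else 0) ∧
      (Mᵀ * M) *ᵥ k = (2 * a) • Pi.single (Sum.inl t) 1 := by
    intro t
    refine ⟨Sum.elim (fun s => if s = t then 1 else 0) (fun j => - b j), fun s => rfl, ?_⟩
    have hMk : M *ᵥ (Sum.elim (fun s => if s = t then 1 else 0) (fun j => - b j))
        = p + (if t = 0 then c else -c) • zt := by
      ext i
      fin_cases t <;>
        simp [hM, hp, Matrix.mulVec, dotProduct, Fintype.sum_sum_type] <;> ring
    rw [← Matrix.mulVec_mulVec, hMk]
    have hcol : ∀ v : Fin n → ℝ, Mᵀ *ᵥ v = Sum.elim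
        (fun s : Fin 2 => if s = 0 then x ⬝ᵥ v + c * (zt ⬝ᵥ v) else x ⬝ᵥ v - c * (zt ⬝ᵥ v))
        (Wᵀ *ᵥ v) := by
      intro v
      ext l
      rcases l with s | j
      · fin_cases s
        · simp [hM, Matrix.mulVec, dotProduct, add_mul, Finset.sum_add_distrib, Finset.mul_sum,
            mul_assoc]
        · simp [hM, Matrix.mulVec, dotProduct, sub_mul, Finset.sum_sub_distrib, Finset.mul_sum,
            mul_assoc]
      · simp [hM, Matrix.mulVec, dotProduct]
    rw [hcol, Matrix.mulVec_add, Matrix.mulVec_smul, hWp, hWz]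
    simp only [dotProduct_add, dotProduct_smul, hxz, hpz, ← ha, smul_eq_mul]
    rw [← ha] at hcc
    ext l
    rcases l with s | j
    · fin_cases t <;> fin_cases s <;> simp <;> linarith
    · simp
  have inv : ∀ t : Fin 2, ∀ s : Fin 2,
      2 * a * (Mᵀ * M)⁻¹ (Sum.inl s) (Sum.inl t) = if s = t then 1 else 0 := by
    intro t s
    obtain ⟨k, hk, hG⟩ := key t
    have h := congrArg (fun v => (Mᵀ * M)⁻¹ *ᵥ v) hG
    simp only [Matrix.mulVec_mulVec, Matrix.nonsing_inv_mul _ hMInv, Matrix.one_mulVec,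
      Matrix.mulVec_smul, Matrix.mulVec_single_one] at h
    rw [← hk s, h]
    simp
  have h00 := inv 0 0
  have h11 := inv 1 1
  have h01 := inv 1 0
  simp only [if_true] at h00 h11
  rw [if_neg (by decide)] at h01
  have ha0 : 2 * a ≠ 0 := by
    intro h
    rw [h, zero_mul] at h00
    exact zero_ne_one h00
  have e1 : (Mᵀ * M)⁻¹ (Sum.inl 0) (Sum.inl 0) = (Mᵀ * M)⁻¹ (Sum.inl 1) (Sum.inl 1) :=
    mul_left_cancel₀ ha0 (h00.trans h11.symm)
  have e2 : (Mᵀ * M)⁻¹ (Sum.inl 0) (Sum.inl 1) = 0 :=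
    (mul_eq_zero.1 h01).resolve_left ha0
  have hψ : ∀ l : Fin 2 ⊕ Fin m, (M *ᵥ ((Mᵀ * M)⁻¹ *ᵥ Pi.single l 1)) ⬝ᵥ
      (M *ᵥ ((Mᵀ * M)⁻¹ *ᵥ Pi.single l 1)) = (Mᵀ * M)⁻¹ l l := by
    intro l
    rw [Matrix.dotProduct_mulVec, ← Matrix.mulVec_transpose, Matrix.mulVec_mulVec,
      Matrix.mulVec_mulVec, Matrix.mul_nonsing_inv _ hMInv, Matrix.one_mulVec]
    simp
  have e3 : ψ₁ ⬝ᵥ ψ₁ = ψ₂ ⬝ᵥ ψ₂ := by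
    rw [hψ₁, hψ₂, hψ, hψ, e1]
  refine ⟨e1, e2, e3, ?_⟩
  rw [add_dotProduct, dotProduct_sub, dotProduct_sub, e3, dotProduct_comm ψ₂ ψ₁]
  ring
end
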